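/- arXiv:quant-ph/0312010 — 2 statements merged into one kernel-verified Lean document; each statement's English description precedes it below -/
import Mathlib

section
/- (Example 1) Let ψ = (0.4, 0.4, 0.1, 0.1) and φ = (0.5, 0.25, 0.22, 0.03). Then ψ^{⊗k} is not majorized by φ^{⊗k} for every integer k with 1 ≤ k ≤ 4, while ψ^{⊗k} is majorized by φ^{⊗k} for every integer k ≥ 5. -/
open Finset

/-- Sum of the `l` largest entries of `x` (maximum over subsets of size `l`),
counted with multiplicity: this is `S_l(x)` from the paper. -/
noncomputable def topSum {ι : Type*} [Fintype ι] (x : ι → ℝ) (l : ℕ) : ℝ :=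
  sSup {s : ℝ | ∃ A : Finset ι, A.card = l ∧ s = ∑ i ∈ A, x i}

/-- Sum of the `l` smallest entries of `x` (minimum over subsets of size `l`). -/
noncomputable def botSum {ι : Type*} [Fintype ι] (x : ι → ℝ) (l : ℕ) : ℝ :=
  sInf {s : ℝ | ∃ A : Finset ι, A.card = l ∧ s = ∑ i ∈ A, x i}

/-- `x` is majorized by `y` (written `x ≺ y`): for every `1 ≤ l ≤ N`,
the sum of the `l` largest entries of `x` is at most that of `y`. -/
def Majorized {ι : Type*} [Fintype ι] (x y : ι → ℝ) : Prop :=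
  ∀ l : ℕ, 1 ≤ l → l ≤ Fintype.card ι → topSum x l ≤ topSum y l

/-- Tensor product of two vectors: all pairwise products of entries. -/
def tensor {ι κ : Type*} (x : ι → ℝ) (z : κ → ℝ) : ι × κ → ℝ :=
  fun p => x p.1 * z p.2

/-- `p`-fold tensor power of a vector. -/
def tensorPow {ι : Type*} (x : ι → ℝ) (p : ℕ) : (Fin p → ι) → ℝ :=
  fun f => ∏ j, x (f j)

/-- Sum of the first `l` entries of a vector `x : Fin n → ℝ`. -/
def prefixSum {n : ℕ} (x : Fin n → ℝ) (l : ℕ) : ℝ :=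
  ∑ j ∈ Finset.univ.filter (fun j : Fin n => (j : ℕ) < l), x j

/-- Sum of the entries of `x : Fin n → ℝ` from index `l` (0-based) on. -/
def suffixSum {n : ℕ} (x : Fin n → ℝ) (l : ℕ) : ℝ :=
  ∑ j ∈ Finset.univ.filter (fun j : Fin n => l ≤ (j : ℕ)), x j

/-- `E_l(x) = 1 - S_{l-1}(x)`: the sum of the entries of the probability vector `x`
from the `l`-th largest to the smallest. -/
noncomputable def Evec {ι : Type*} [Fintype ι] (x : ι → ℝ) (l : ℕ) : ℝ :=
  1 - topSum x (l - 1)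

/-- Vidal conversion probability `P(x → y) = min_{1 ≤ l ≤ N} E_l(x)/E_l(y)`. -/
noncomputable def vidalP {ι : Type*} [Fintype ι] (x y : ι → ℝ) : ℝ :=
  sInf {r : ℝ | ∃ l : ℕ, 1 ≤ l ∧ l ≤ Fintype.card ι ∧ r = Evec x l / Evec y l}

/-- Nonincreasing rearrangement of the entries of `x`, as a list. -/
noncomputable def sortedDesc {ι : Type*} [Fintype ι] (x : ι → ℝ) : List ℝ :=
  ((Finset.univ.val.map x).sort (· ≤ ·)).reverse

/-- `x` is weakly dominated by `y`: every hinge sum of `x` at a nonnegative threshold is at most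
the corresponding hinge sum of `y`. -/
def HingeLE {ι κ : Type*} [Fintype ι] [Fintype κ] (x : ι → ℝ) (y : κ → ℝ) : Prop :=
  ∀ t : ℝ, 0 ≤ t → ∑ i, max (x i - t) 0 ≤ ∑ j, max (y j - t) 0

section TopSum

variable {ι : Type*} [Fintype ι]

theorem sum_le_hinge (x : ι → ℝ) (A : Finset ι) (t : ℝ) :
    ∑ i ∈ A, x i ≤ A.card * t + ∑ i, max (x i - t) 0 := by
  have h1 : ∑ i ∈ A, (x i - t) ≤ ∑ i, max (x i - t) 0 :=
    (sum_le_sum fun i _ => le_max_left _ _).trans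
      (sum_le_sum_of_subset_of_nonneg (subset_univ A) fun i _ _ => le_max_right _ _)
  rw [sum_sub_distrib, sum_const, nsmul_eq_mul] at h1
  linarith

theorem topSum_bddAbove (x : ι → ℝ) (l : ℕ) :
    BddAbove {s : ℝ | ∃ A : Finset ι, A.card = l ∧ s = ∑ i ∈ A, x i} := by
  refine ⟨l * 0 + ∑ i, max (x i - 0) 0, ?_⟩
  rintro _ ⟨A, rfl, rfl⟩
  exact sum_le_hinge x A 0

theorem sum_le_topSum (x : ι → ℝ) (A : Finset ι) : ∑ i ∈ A, x i ≤ topSum x A.card :=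
  le_csSup (topSum_bddAbove x _) ⟨A, rfl, rfl⟩

theorem topSum_le_hinge (x : ι → ℝ) {l : ℕ} (hl : l ≤ Fintype.card ι) (t : ℝ) :
    topSum x l ≤ l * t + ∑ i, max (x i - t) 0 := by
  obtain ⟨A, -, hA⟩ := exists_subset_card_eq (s := (univ : Finset ι)) hl
  refine csSup_le ⟨_, A, hA, rfl⟩ ?_
  rintro _ ⟨B, rfl, rfl⟩
  exact sum_le_hinge x B t

theorem exists_hinge_le_topSum {y : ι → ℝ} (hy : ∀ i, 0 ≤ y i) {l : ℕ} (h1 : 1 ≤ l)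
    (hl : l ≤ Fintype.card ι) :
    ∃ t : ℝ, 0 ≤ t ∧ l * t + ∑ i, max (y i - t) 0 ≤ topSum y l := by
  classical
  obtain ⟨A, hA, hmax⟩ := exists_max_image (powersetCard l (univ : Finset ι))
    (fun A => ∑ i ∈ A, y i) (powersetCard_nonempty.2 hl)
  have hcard : A.card = l := (mem_powersetCard.1 hA).2
  obtain ⟨a, ha, hmin⟩ := exists_min_image A y (card_pos.1 (by omega))
  have hout : ∀ j, j ∉ A → y j ≤ y a := by
    intro j hj
    have hj' : j ∉ A.erase a := fun h => hj (mem_of_mem_erase h)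
    have h := hmax (insert j (A.erase a)) (mem_powersetCard.2 ⟨subset_univ _, by
      rw [card_insert_of_notMem hj', card_erase_of_mem ha]; omega⟩)
    rw [sum_insert hj', ← add_sum_erase A y ha] at h
    linarith
  refine ⟨y a, hy a, le_trans (le_of_eq ?_) (hcard ▸ sum_le_topSum y A)⟩
  have h2 : ∑ i, max (y i - y a) 0 = ∑ i ∈ A, (y i - y a) := by
    rw [← sum_subset (subset_univ A)]
    · exact sum_congr rfl fun i hi => max_eq_left (sub_nonneg.2 (hmin i hi))
    · exact fun j _ hj => max_eq_right (sub_nonpos.2 (hout j hj))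
  rw [h2, sum_sub_distrib, sum_const, nsmul_eq_mul, hcard]
  ring

theorem HingeLE.majorized {x y : ι → ℝ} (h : HingeLE x y) (hy : ∀ i, 0 ≤ y i) :
    Majorized x y := by
  intro l h1 hl
  obtain ⟨t, ht, hle⟩ := exists_hinge_le_topSum hy h1 hl
  linarith [topSum_le_hinge x hl t, h t ht]

end TopSum

section Tensor

theorem tensorPow_nonneg {ι : Type*} {x : ι → ℝ} (hx : ∀ i, 0 ≤ x i) (k : ℕ) (f : Fin k → ι) :
    0 ≤ tensorPow x k f :=
  prod_nonneg fun _ _ => hx _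

variable {ι κ μ ν : Type*} [Fintype ι] [Fintype κ] [Fintype μ] [Fintype ν]

theorem max_mul_sub_zero {c : ℝ} (hc : 0 < c) (a t : ℝ) :
    max (a * c - t) 0 = c * max (a - t / c) 0 := by
  rw [mul_max_of_nonneg _ _ hc.le, mul_zero, mul_sub, mul_div_cancel₀ _ hc.ne', mul_comm]

theorem HingeLE.mul_const {x : ι → ℝ} {y : κ → ℝ} (h : HingeLE x y) {c : ℝ} (hc : 0 ≤ c) :
    ∀ t : ℝ, 0 ≤ t → ∑ i, max (x i * c - t) 0 ≤ ∑ j, max (y j * c - t) 0 := by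
  intro t ht
  rcases hc.eq_or_lt with rfl | hc
  · simp [ht]
  · simp only [max_mul_sub_zero hc, ← mul_sum]
    exact mul_le_mul_of_nonneg_left (h _ (div_nonneg ht hc.le)) hc.le

theorem HingeLE.tensor {x : ι → ℝ} {y : κ → ℝ} {z : μ → ℝ} {w : ν → ℝ}
    (h : HingeLE x y) (h' : HingeLE z w) (hz : ∀ i, 0 ≤ z i) (hy : ∀ i, 0 ≤ y i) :
    HingeLE (tensor x z) (tensor y w) := by
  intro t ht
  calc ∑ p, max (_root_.tensor x z p - t) 0 = ∑ k, ∑ i, max (x i * z k - t) 0 :=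
        Fintype.sum_prod_type_right _
    _ ≤ ∑ k, ∑ j, max (y j * z k - t) 0 :=
        sum_le_sum fun k _ => h.mul_const (hz k) t ht
    _ = ∑ j, ∑ k, max (z k * y j - t) 0 := by
        rw [sum_comm]; simp only [mul_comm]
    _ ≤ ∑ j, ∑ k, max (w k * y j - t) 0 :=
        sum_le_sum fun j _ => h'.mul_const (hy j) t ht
    _ = ∑ p, max (_root_.tensor y w p - t) 0 := by
        rw [Fintype.sum_prod_type]; simp only [_root_.tensor, mul_comm]

theorem sum_tensorPow_add (x : ι → ℝ) (a b : ℕ) (g : ℝ → ℝ) :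
    ∑ f, g (tensorPow x (a + b) f) = ∑ p, g (tensor (tensorPow x a) (tensorPow x b) p) := by
  rw [← (Fin.appendEquiv a b).sum_comp]
  refine sum_congr rfl fun p _ => ?_
  simp [tensorPow, _root_.tensor, Fin.prod_univ_add, Fin.appendEquiv]

theorem HingeLE.tensorPow_add {x : ι → ℝ} {y : κ → ℝ} (hx : ∀ i, 0 ≤ x i) (hy : ∀ i, 0 ≤ y i)
    {a b : ℕ} (ha : HingeLE (tensorPow x a) (tensorPow y a))
    (hb : HingeLE (tensorPow x b) (tensorPow y b)) :
    HingeLE (tensorPow x (a + b)) (tensorPow y (a + b)) := by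
  intro t ht
  rw [sum_tensorPow_add x a b fun v => max (v - t) 0,
    sum_tensorPow_add y a b fun v => max (v - t) 0]
  exact ha.tensor hb (tensorPow_nonneg hx b) (tensorPow_nonneg hy a) t ht

end Tensor

section Spectrum

/-- Sum of `g` over a list of pairs (value, multiplicity). -/
def weightedSum {R : Type*} [Semiring R] (g : ℕ → R) : List (ℕ × ℕ) → R
  | [] => 0
  | p :: L => p.2 * g p.1 + weightedSum g L

/-- Insert a value with multiplicity into a list sorted by decreasing value. -/
def insertValue (v m : ℕ) : List (ℕ × ℕ) → List (ℕ × ℕ)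
  | [] => [(v, m)]
  | p :: L =>
    bif v == p.1 then (v, m + p.2) :: L
    else bif p.1.ble v then (v, m) :: p :: L
    else p :: insertValue v m L

/-- Insert all values of a list, scaled by `c`, into another list. -/
def insertScaled (c : ℕ) : List (ℕ × ℕ) → List (ℕ × ℕ) → List (ℕ × ℕ)
  | [], L => L
  | p :: M, L => insertValue (c * p.1) p.2 (insertScaled c M L)

/-- Values with multiplicities of the `k`-fold tensor power of `(a, b, c, d)`. -/
def powSpectrum (a b c d : ℕ) : ℕ → List (ℕ × ℕ)
  | 0 => [(1, 1)]
  | k + 1 =>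
    let L := powSpectrum a b c d k
    insertScaled a L (insertScaled b L (insertScaled c L (insertScaled d L [])))

variable {R : Type*} [Semiring R]

theorem weightedSum_insertValue (g : ℕ → R) (v m : ℕ) (L : List (ℕ × ℕ)) :
    weightedSum g (insertValue v m L) = m * g v + weightedSum g L := by
  induction L with
  | nil => simp [insertValue, weightedSum]
  | cons p L ih =>
    simp only [insertValue, cond_eq_ite]
    split_ifs with h1 h2
    · obtain rfl := beq_iff_eq.1 h1
      simp [weightedSum, add_mul, add_assoc]
    · rfl
    · simp only [weightedSum, ih]
      exact add_left_comm _ _ _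

theorem weightedSum_insertScaled (g : ℕ → R) (c : ℕ) (M L : List (ℕ × ℕ)) :
    weightedSum g (insertScaled c M L) =
      weightedSum (fun v => g (c * v)) M + weightedSum g L := by
  induction M with
  | nil => simp [insertScaled, weightedSum]
  | cons p M ih => simp [insertScaled, weightedSum, weightedSum_insertValue, ih, add_assoc]

theorem sum_pow_eq_weightedSum (a b c d k : ℕ) (g : ℕ → R) :
    ∑ f : Fin k → Fin 4, g (∏ j, ![a, b, c, d] (f j)) =
      weightedSum g (powSpectrum a b c d k) := by
  induction k generalizing g with
  | zero => simp [powSpectrum, weightedSum]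
  | succ k ih =>
    rw [← (Fin.consEquiv fun _ => Fin 4).sum_comp, Fintype.sum_prod_type]
    simp [Fin.sum_univ_four, Fin.prod_univ_succ, Fin.consEquiv, powSpectrum,
      weightedSum_insertScaled, weightedSum, ← ih, add_assoc]

/-- Total of the `l` leading values (with multiplicity) of a list of pairs. -/
def leadingSum : List (ℕ × ℕ) → ℕ → ℕ
  | [], _ => 0
  | p :: L, l => min p.2 l * p.1 + leadingSum L (l - min p.2 l)

theorem leadingSum_sub_le (L : List (ℕ × ℕ)) (l : ℕ) {t : ℝ} (ht : 0 ≤ t) :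
    (leadingSum L l : ℝ) - l * t ≤ weightedSum (fun v => max ((v : ℝ) - t) 0) L := by
  induction L generalizing l with
  | nil => simpa [leadingSum, weightedSum] using mul_nonneg l.cast_nonneg ht
  | cons p L ih =>
    have h := ih (l - min p.2 l)
    have h1 : ((min p.2 l : ℕ) : ℝ) * (p.1 - t) ≤ p.2 * max ((p.1 : ℝ) - t) 0 :=
      (mul_le_mul_of_nonneg_left (le_max_left _ 0) (Nat.cast_nonneg _)).trans
        (mul_le_mul_of_nonneg_right (Nat.cast_le.2 (min_le_left _ _)) (le_max_right _ _))
    rw [Nat.cast_sub (min_le_right _ _)] at h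
    simp only [leadingSum, weightedSum, Nat.cast_add, Nat.cast_mul]
    linarith

/-- Checks that `M`, preceded by `l` values of total `s`, has decreasing values bounded by `u`, and
that at each block boundary the partial sums are bounded by the leading sums of `L`. -/
def lorenzCheck (L : List (ℕ × ℕ)) : List (ℕ × ℕ) → ℕ → ℕ → ℕ → Bool
  | [], _, l, s => s.ble (leadingSum L l)
  | p :: M, u, l, s =>
    s.ble (leadingSum L l) && p.1.ble u && lorenzCheck L M p.1 (l + p.2) (s + p.2 * p.1)

theorem lorenzCheck_values {L M : List (ℕ × ℕ)} {u l s : ℕ} (h : lorenzCheck L M u l s)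
    {t : ℝ} (hut : (u : ℝ) ≤ t) : weightedSum (fun v => max ((v : ℝ) - t) 0) M = 0 := by
  induction M generalizing u l s with
  | nil => rfl
  | cons p M ih =>
    simp only [lorenzCheck, Bool.and_eq_true, Nat.ble_eq] at h
    have hp : (p.1 : ℝ) ≤ t := (Nat.cast_le.2 h.1.2).trans hut
    simp [weightedSum, ih h.2 hp, hp]

theorem weightedSum_le_of_lorenzCheck {L M : List (ℕ × ℕ)} {u l s : ℕ}
    (h : lorenzCheck L M u l s) {t : ℝ} (ht : 0 ≤ t) :
    (s : ℝ) - l * t + weightedSum (fun v => max ((v : ℝ) - t) 0) M ≤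
      weightedSum (fun v => max ((v : ℝ) - t) 0) L := by
  induction M generalizing u l s with
  | nil =>
    have h' : (s : ℝ) ≤ leadingSum L l := Nat.cast_le.2 (Nat.le_of_ble_eq_true h)
    have := leadingSum_sub_le L l ht
    simp only [weightedSum]
    linarith
  | cons p M ih =>
    simp only [lorenzCheck, Bool.and_eq_true, Nat.ble_eq] at h
    rcases le_total (p.1 : ℝ) t with hp | hp
    · have h' : (s : ℝ) ≤ leadingSum L l := Nat.cast_le.2 h.1.1
      have := leadingSum_sub_le L l ht
      simp only [weightedSum, lorenzCheck_values h.2 hp, max_eq_right (sub_nonpos.2 hp)]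
      linarith
    · have := ih h.2
      simp only [weightedSum, max_eq_left (sub_nonneg.2 hp)]
      push_cast at this
      linarith

end Spectrum

theorem tensorPow_div (a : Fin 4 → ℕ) (c : ℝ) (k : ℕ) (f : Fin k → Fin 4) :
    tensorPow (fun i => (a i : ℝ) / c) k f = ((∏ j, a (f j) : ℕ) : ℝ) * (c ^ k)⁻¹ := by
  simp [tensorPow, div_eq_mul_inv, prod_mul_distrib]

theorem hingeLE_tensorPow_of_lorenzCheck {a b c d a' b' c' d' k u : ℕ}
    (h : lorenzCheck (powSpectrum a' b' c' d' k) (powSpectrum a b c d k) u 0 0)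
    {r : ℝ} (hr : 0 < r) :
    HingeLE (tensorPow (fun i => (![a, b, c, d] i : ℝ) / r) k)
      (tensorPow (fun i => (![a', b', c', d'] i : ℝ) / r) k) := by
  have key : HingeLE (fun f : Fin k → Fin 4 => ((∏ j, ![a, b, c, d] (f j) : ℕ) : ℝ))
      (fun f : Fin k → Fin 4 => ((∏ j, ![a', b', c', d'] (f j) : ℕ) : ℝ)) := by
    intro t ht
    rw [sum_pow_eq_weightedSum a b c d k fun v => max ((v : ℝ) - t) 0,
      sum_pow_eq_weightedSum a' b' c' d' k fun v => max ((v : ℝ) - t) 0]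
    simpa using weightedSum_le_of_lorenzCheck h ht
  intro t ht
  simp only [tensorPow_div]
  exact key.mul_const (by positivity) t ht

theorem psi_eq : (![0.4, 0.4, 0.1, 0.1] : Fin 4 → ℝ) =
    fun i => ((![40, 40, 10, 10] : Fin 4 → ℕ) i : ℝ) / 100 := by
  funext i; fin_cases i <;> norm_num

theorem phi_eq : (![0.5, 0.25, 0.22, 0.03] : Fin 4 → ℝ) =
    fun i => ((![50, 25, 22, 3] : Fin 4 → ℕ) i : ℝ) / 100 := by
  funext i; fin_cases i <;> norm_num

theorem hingeLE_tensorPow_psi_phi {k : ℕ} (hk : 5 ≤ k) :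
    HingeLE (tensorPow (![0.4, 0.4, 0.1, 0.1] : Fin 4 → ℝ) k)
      (tensorPow (![0.5, 0.25, 0.22, 0.03] : Fin 4 → ℝ) k) := by
  rw [psi_eq, phi_eq]
  induction k using Nat.strong_induction_on with
  | _ k ih =>
    rcases lt_or_ge k 10 with h | h
    · have hc : ∀ n ∈ Finset.Ico 5 10, lorenzCheck (powSpectrum 50 25 22 3 n)
          (powSpectrum 40 40 10 10 n) (100 ^ n) 0 0 := by decide +kernel
      exact hingeLE_tensorPow_of_lorenzCheck (hc k (Finset.mem_Ico.2 ⟨hk, h⟩)) (by norm_num)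
    · obtain ⟨n, rfl⟩ := Nat.exists_eq_add_of_le' hk
      exact HingeLE.tensorPow_add (fun _ => by positivity) (fun _ => by positivity)
        (ih n (by omega) (by omega)) (ih 5 (by omega) le_rfl)

/-- The entries indexed by words in the letters `0` and `1` bound a top sum from below. -/
theorem pow_le_topSum_tensorPow (x : Fin 4 → ℝ) (k : ℕ) :
    (x 0 + x 1) ^ k ≤ topSum (tensorPow x k) (2 ^ k) := by
  have h := sum_le_topSum (tensorPow x k) (Fintype.piFinset fun _ => ({0, 1} : Finset (Fin 4)))
  have hs : ∑ f ∈ Fintype.piFinset fun _ : Fin k => ({0, 1} : Finset (Fin 4)), tensorPow x k f =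
      (x 0 + x 1) ^ k := by
    simp only [tensorPow, ← prod_univ_sum]
    simp
  simpa [hs] using h

theorem topSum_tensorPow_le (a b c d k : ℕ) {l : ℕ} (hl : l ≤ 4 ^ k) (s : ℕ) {r : ℝ} (hr : 0 < r) :
    topSum (tensorPow (fun i => (![a, b, c, d] i : ℝ) / r) k) l ≤
      ((l * s + weightedSum (fun v => v - s) (powSpectrum a b c d k) : ℕ) : ℝ) / r ^ k := by
  have h := topSum_le_hinge (tensorPow (fun i => (![a, b, c, d] i : ℝ) / r) k) (l := l)
    (by simpa using hl) (s / r ^ k)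
  refine h.trans (le_of_eq ?_)
  have hrk : 0 < (r ^ k)⁻¹ := by positivity
  have hsub : ∀ v : ℕ, max ((v : ℝ) - s) 0 = ((v - s : ℕ) : ℝ) := by
    intro v
    rcases le_total s v with h | h
    · rw [Nat.cast_sub h, max_eq_left (by simpa using h)]
    · rw [Nat.sub_eq_zero_of_le h, max_eq_right (by simpa using h), Nat.cast_zero]
  simp only [tensorPow_div, max_mul_sub_zero hrk, div_inv_eq_mul, ← mul_sum]
  rw [div_mul_cancel₀ _ (by positivity : r ^ k ≠ 0), ← sum_pow_eq_weightedSum]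
  simp only [hsub, ← Nat.cast_sum]
  push_cast
  ring

theorem not_majorized_tensorPow_psi_phi {k : ℕ} (h1 : 1 ≤ k) (h4 : k ≤ 4) :
    ¬ Majorized (tensorPow (![0.4, 0.4, 0.1, 0.1] : Fin 4 → ℝ) k)
      (tensorPow (![0.5, 0.25, 0.22, 0.03] : Fin 4 → ℝ) k) := by
  intro h
  have hle : 2 ^ k ≤ 4 ^ k := Nat.pow_le_pow_left (by norm_num) k
  have h2 := h (2 ^ k) Nat.one_le_two_pow (by simpa using hle)
  have h3 := (pow_le_topSum_tensorPow _ k).trans h2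
  rw [phi_eq] at h3
  have hc : ∃ s, 2 ^ k * s + weightedSum (fun v => v - s) (powSpectrum 50 25 22 3 k) < 80 ^ k := by
    interval_cases k
    exacts [⟨25, by decide +kernel⟩, ⟨1100, by decide +kernel⟩, ⟨31250, by decide +kernel⟩,
      ⟨1375000, by decide +kernel⟩]
  obtain ⟨s, hs⟩ := hc
  have h5 := h3.trans (topSum_tensorPow_le 50 25 22 3 k hle s (by norm_num))
  rw [le_div_iff₀ (by positivity), ← mul_pow] at h5
  have h80 : (![0.4, 0.4, 0.1, 0.1] 0 + ![0.4, 0.4, 0.1, 0.1] 1 : ℝ) * 100 = (80 : ℕ) := by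
    norm_num
  rw [h80, ← Nat.cast_pow, Nat.cast_le] at h5
  exact absurd h5 (not_le.2 hs)

theorem stmt_15 :
    (∀ k : ℕ, 1 ≤ k → k ≤ 4 →
      ¬ Majorized (tensorPow (![0.4, 0.4, 0.1, 0.1] : Fin 4 → ℝ) k)
        (tensorPow (![0.5, 0.25, 0.22, 0.03] : Fin 4 → ℝ) k)) ∧
    (∀ k : ℕ, 5 ≤ k →
      Majorized (tensorPow (![0.4, 0.4, 0.1, 0.1] : Fin 4 → ℝ) k)
        (tensorPow (![0.5, 0.25, 0.22, 0.03] : Fin 4 → ℝ) k)) := by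
  exact ⟨fun k h1 h4 => not_majorized_tensorPow_psi_phi h1 h4,
    fun k hk => (hingeLE_tensorPow_psi_phi hk).majorized
      (tensorPow_nonneg (fun i => by rw [phi_eq]; positivity) k)⟩
end

section
/- (Example 2, extreme case) Let ψ = (0.4, 0.4, 0.1, 0.1), φ = (0.5, 0.25, 0.2, 0.05) and c = (0.6, 0.4). Then for every integer k ≥ 1, ψ⊗c^{⊗k} is majorized by φ⊗c^{⊗k} if and only if k ≥ 11; that is, at least 11 copies of the catalyst c are needed to convert a single copy of ψ into φ. -/
open Finset

/-- Total excess of the entries of `x` over the threshold `t`. -/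
noncomputable def excess {ι : Type*} [Fintype ι] (x : ι → ℝ) (t : ℝ) : ℝ :=
  ∑ i, max (x i - t) 0

section Majorization

variable {ι : Type*} [Fintype ι]

theorem finite_subset_sums (x : ι → ℝ) (l : ℕ) :
    {s : ℝ | ∃ A : Finset ι, A.card = l ∧ s = ∑ i ∈ A, x i}.Finite :=
  (Set.finite_range fun A : Finset ι => ∑ i ∈ A, x i).subset <| by
    rintro s ⟨A, -, rfl⟩
    exact ⟨A, rfl⟩

theorem exists_sum_eq_topSum (x : ι → ℝ) {l : ℕ} (hl : l ≤ Fintype.card ι) :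
    ∃ A : Finset ι, A.card = l ∧ topSum x l = ∑ i ∈ A, x i := by
  obtain ⟨A, -, hA⟩ := Finset.exists_subset_card_eq (s := Finset.univ) (n := l) (by simpa using hl)
  exact Set.Nonempty.csSup_mem (s := {s : ℝ | ∃ A : Finset ι, A.card = l ∧ s = ∑ i ∈ A, x i})
    ⟨_, A, hA, rfl⟩ (finite_subset_sums x l)

theorem sum_le_excess (x : ι → ℝ) (t : ℝ) (A : Finset ι) :
    ∑ i ∈ A, x i ≤ excess x t + A.card * t := by
  have h : ∑ i ∈ A, (x i - t) ≤ excess x t :=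
    (Finset.sum_le_sum fun i _ => le_max_left (x i - t) 0).trans
      (Finset.sum_le_univ_sum_of_nonneg fun i => le_max_right _ _)
  rw [Finset.sum_sub_distrib, Finset.sum_const, nsmul_eq_mul] at h
  linarith

theorem excess_eq_of_threshold {x : ι → ℝ} {t : ℝ} {A : Finset ι}
    (hA : ∀ i ∈ A, t ≤ x i) (hA' : ∀ i ∉ A, x i ≤ t) :
    excess x t + A.card * t = ∑ i ∈ A, x i := by
  have h : ∑ i ∈ A, (x i - t) = excess x t := by
    rw [excess, ← Finset.sum_subset (Finset.subset_univ A)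
      (fun i _ hi => max_eq_right (by linarith [hA' i hi]))]
    exact Finset.sum_congr rfl fun i hi => (max_eq_left (by linarith [hA i hi])).symm
  rw [Finset.sum_sub_distrib, Finset.sum_const, nsmul_eq_mul] at h
  linarith

theorem Majorized.excess_le {x y : ι → ℝ} (h : Majorized x y) (t : ℝ) :
    excess x t ≤ excess y t := by
  classical
  set A : Finset ι := Finset.univ.filter fun i => t < x i with hA
  have hx : excess x t + A.card * t = ∑ i ∈ A, x i :=
    excess_eq_of_threshold (fun i hi => (Finset.mem_filter.1 hi).2.le)
      (fun i hi => by simpa [hA] using hi)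
  obtain ⟨B, hB, hyB⟩ := exists_sum_eq_topSum y (Finset.card_le_univ A)
  have hxy : topSum x A.card ≤ topSum y A.card := by
    rcases Nat.eq_zero_or_pos A.card with h0 | h0
    · simp [h0, topSum]
    · exact h _ h0 (Finset.card_le_univ A)
  have hy := sum_le_excess y t B
  rw [hB] at hy
  linarith [sum_le_topSum x A]

/-- It suffices to compare excesses at the thresholds that are entries of the larger vector. -/
theorem majorized_of_excess_le {x y : ι → ℝ} (h : ∀ i, excess x (y i) ≤ excess y (y i)) :
    Majorized x y := by
  classical
  intro l hl hl'
  obtain ⟨B, hB, hyB⟩ := exists_sum_eq_topSum y hl'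
  obtain ⟨A, hA, hxA⟩ := exists_sum_eq_topSum x hl'
  obtain ⟨b, hb, hmin⟩ := Finset.exists_min_image B y (Finset.card_pos.1 (by omega))
  have hout : ∀ i ∉ B, y i ≤ y b := by
    intro i hi
    have hi' : i ∉ B.erase b := fun h => hi (Finset.mem_of_mem_erase h)
    have hcard : (insert i (B.erase b)).card = l := by
      rw [Finset.card_insert_of_notMem hi', Finset.card_erase_of_mem hb]
      omega
    have hle := sum_le_topSum y (insert i (B.erase b))
    rw [hcard, hyB, Finset.sum_insert hi', ← Finset.add_sum_erase B y hb] at hle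
    linarith
  have hy := excess_eq_of_threshold hmin hout
  have hx := sum_le_excess x (y b) A
  rw [hB] at hy
  rw [hA] at hx
  linarith [h b]

end Majorization

section TensorPower

variable {ι κ : Type*} [Fintype ι] [Fintype κ]

theorem sum_tensorPow_succ (z : κ → ℝ) (k : ℕ) (g : ℝ → ℝ) :
    ∑ f, g (tensorPow z (k + 1) f) = ∑ b, ∑ f, g (z b * tensorPow z k f) := by
  rw [← (Fin.consEquiv fun _ : Fin (k + 1) => κ).sum_comp, Fintype.sum_prod_type]
  simp [tensorPow, Fin.prod_univ_succ, Fin.consEquiv]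

theorem excess_tensor (x : ι → ℝ) (z : κ → ℝ) (t : ℝ) :
    excess (tensor x z) t = ∑ i, ∑ j, max (x i * z j - t) 0 :=
  Fintype.sum_prod_type _

theorem excess_tensor_tensorPow_succ (x : ι → ℝ) {z : κ → ℝ} (hz : ∀ b, 0 < z b) (k : ℕ) (t : ℝ) :
    excess (tensor x (tensorPow z (k + 1))) t =
      ∑ b, z b * excess (tensor x (tensorPow z k)) (t / z b) := by
  simp only [excess_tensor]
  rw [Finset.sum_congr rfl fun i _ =>
    sum_tensorPow_succ z k fun w => max (x i * w - t) 0, Finset.sum_comm]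
  refine Finset.sum_congr rfl fun b _ => ?_
  simp only [Finset.mul_sum]
  refine Finset.sum_congr rfl fun i _ => Finset.sum_congr rfl fun f _ => ?_
  rw [mul_max_of_nonneg _ _ (hz b).le, mul_zero, mul_sub, mul_div_cancel₀ _ (hz b).ne',
    mul_left_comm]

theorem Majorized.tensorPow_mono {x y : ι → ℝ} {z : κ → ℝ} (hz : ∀ b, 0 < z b) {k n : ℕ}
    (hkn : k ≤ n) (h : Majorized (tensor x (tensorPow z k)) (tensor y (tensorPow z k))) :
    Majorized (tensor x (tensorPow z n)) (tensor y (tensorPow z n)) := by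
  induction n, hkn using Nat.le_induction with
  | base => exact h
  | succ n _ ih =>
    refine majorized_of_excess_le fun i => ?_
    rw [excess_tensor_tensorPow_succ x hz, excess_tensor_tensorPow_succ y hz]
    exact Finset.sum_le_sum fun b _ => mul_le_mul_of_nonneg_left (ih.excess_le _) (hz b).le

theorem sum_tensorPow_pair (a b : ℝ) (k : ℕ) (g : ℝ → ℝ) :
    ∑ f, g (tensorPow ![a, b] k f) =
      ∑ p ∈ antidiagonal k, (k.choose p.1 : ℝ) * g (a ^ p.1 * b ^ p.2) := by
  induction k generalizing g with
  | zero => simp [tensorPow]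
  | succ k ih =>
    have h := Finset.sum_antidiagonal_choose_succ_mul (fun m n => g (a ^ m * b ^ n)) k
    rw [h, sum_tensorPow_succ, Fin.sum_univ_two, add_comm]
    refine congrArg₂ _ ((ih fun w => g (b * w)).trans ?_) ((ih fun w => g (a * w)).trans ?_)
    · exact Finset.sum_congr rfl fun p _ => by rw [pow_succ, mul_left_comm, mul_comm b]
    · refine Finset.sum_congr rfl fun p hp => ?_
      rw [pow_succ', mul_assoc,
        ← Nat.choose_symm_of_eq_add (HasAntidiagonal.mem_antidiagonal.1 hp).symm]

theorem tensorPow_pair_eq (a b : ℝ) (k : ℕ) (f : Fin k → Fin 2) :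
    ∃ p ∈ antidiagonal k, tensorPow ![a, b] k f = a ^ p.1 * b ^ p.2 := by
  induction k with
  | zero => exact ⟨(0, 0), by simp [tensorPow]⟩
  | succ k ih =>
    obtain ⟨⟨m, n⟩, hp, h⟩ := ih (Fin.tail f)
    rw [HasAntidiagonal.mem_antidiagonal] at hp
    have h' : tensorPow ![a, b] (k + 1) f = ![a, b] (f 0) * (a ^ m * b ^ n) := by
      rw [← h]
      exact Fin.prod_univ_succ _
    rcases Fin.exists_fin_two.1 ⟨f 0, rfl⟩ with h0 | h0
    · refine ⟨(m + 1, n), HasAntidiagonal.mem_antidiagonal.2 (by simp only at hp ⊢; omega), ?_⟩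
      simp [h', h0, pow_succ', mul_assoc]
    · refine ⟨(m, n + 1), HasAntidiagonal.mem_antidiagonal.2 (by simp only at hp ⊢; omega), ?_⟩
      simp [h', h0, pow_succ', mul_left_comm]

end TensorPower

/-- Excess of `X ⊗ (3, 2)^{⊗k}` over the threshold `T`, in natural numbers. -/
def natExcess (X : Fin 4 → ℕ) (k T : ℕ) : ℕ :=
  ∑ i, ∑ p ∈ antidiagonal k, k.choose p.1 * (X i * (3 ^ p.1 * 2 ^ p.2) - T)

theorem cast_tsub_eq_max (m n : ℕ) : ((m - n : ℕ) : ℝ) = max ((m : ℝ) - n) 0 := by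
  rcases le_total n m with h | h
  · rw [Nat.cast_sub h, max_eq_left (sub_nonneg.2 (Nat.cast_le.2 h))]
  · rw [Nat.sub_eq_zero_of_le h, Nat.cast_zero,
      max_eq_right (sub_nonpos.2 (Nat.cast_le.2 h))]

theorem excess_eq_natExcess (X : Fin 4 → ℕ) (k T : ℕ) :
    excess (tensor (fun i => (X i : ℝ) / 20) (tensorPow ![0.6, 0.4] k)) (T / (20 * 5 ^ k)) =
      natExcess X k T / (20 * 5 ^ k) := by
  rw [excess_tensor, natExcess, Nat.cast_sum, Finset.sum_div]
  refine Finset.sum_congr rfl fun i _ => ?_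
  rw [sum_tensorPow_pair _ _ _ fun w => max ((X i : ℝ) / 20 * w - T / (20 * 5 ^ k)) 0,
    Nat.cast_sum, Finset.sum_div]
  refine Finset.sum_congr rfl fun p hp => ?_
  have h5 : (0 : ℝ) < 20 * 5 ^ k := by positivity
  rw [Nat.cast_mul, cast_tsub_eq_max, mul_div_assoc, ← max_div_div_right h5.le, zero_div, sub_div,
    ← HasAntidiagonal.mem_antidiagonal.1 hp]
  push_cast
  rw [show (0.6 : ℝ) = 3 / 5 by norm_num, show (0.4 : ℝ) = 2 / 5 by norm_num, div_pow, div_pow,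
    pow_add]
  congr 3
  field_simp

theorem natExcess_le_eleven :
    ∀ i : Fin 4, ∀ p ∈ antidiagonal 11,
      natExcess ![8, 8, 2, 2] 11 (![10, 5, 4, 1] i * (3 ^ p.1 * 2 ^ p.2)) ≤
        natExcess ![10, 5, 4, 1] 11 (![10, 5, 4, 1] i * (3 ^ p.1 * 2 ^ p.2)) := by
  decide +kernel

theorem natExcess_lt_ten :
    natExcess ![10, 5, 4, 1] 10 (10 * (3 ^ 5 * 2 ^ 5)) <
      natExcess ![8, 8, 2, 2] 10 (10 * (3 ^ 5 * 2 ^ 5)) := by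
  decide +kernel

theorem stmt_18 :
    ∀ k : ℕ, 1 ≤ k →
      (Majorized
        (tensor (![0.4, 0.4, 0.1, 0.1] : Fin 4 → ℝ)
          (tensorPow (![0.6, 0.4] : Fin 2 → ℝ) k))
        (tensor (![0.5, 0.25, 0.2, 0.05] : Fin 4 → ℝ)
          (tensorPow (![0.6, 0.4] : Fin 2 → ℝ) k)) ↔ 11 ≤ k) := by
  intro k _
  have hz : ∀ b, (0 : ℝ) < (![0.6, 0.4] : Fin 2 → ℝ) b := by
    intro b
    fin_cases b <;> norm_num
  have hψ : (![0.4, 0.4, 0.1, 0.1] : Fin 4 → ℝ) =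
      fun i => ((![8, 8, 2, 2] : Fin 4 → ℕ) i : ℝ) / 20 := by
    ext i
    fin_cases i <;> norm_num
  have hφ : (![0.5, 0.25, 0.2, 0.05] : Fin 4 → ℝ) =
      fun i => ((![10, 5, 4, 1] : Fin 4 → ℕ) i : ℝ) / 20 := by
    ext i
    fin_cases i <;> norm_num
  rw [hψ, hφ]
  constructor
  · intro h
    by_contra! hk
    have h10 := (h.tensorPow_mono hz (Nat.le_of_lt_succ hk)).excess_le
      ((10 * (3 ^ 5 * 2 ^ 5) : ℕ) / (20 * 5 ^ 10))
    rw [excess_eq_natExcess, excess_eq_natExcess,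
      div_le_div_iff_of_pos_right (by positivity), Nat.cast_le] at h10
    exact absurd natExcess_lt_ten h10.not_gt
  · intro hk
    refine Majorized.tensorPow_mono hz hk (majorized_of_excess_le ?_)
    rintro ⟨i, f⟩
    obtain ⟨p, hp, hpf⟩ := tensorPow_pair_eq 0.6 0.4 11 f
    have ht : tensor (fun i => ((![10, 5, 4, 1] : Fin 4 → ℕ) i : ℝ) / 20)
        (tensorPow ![0.6, 0.4] 11) (i, f) =
        ((![10, 5, 4, 1] i * (3 ^ p.1 * 2 ^ p.2) : ℕ) : ℝ) / (20 * 5 ^ 11) := by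
      rw [tensor, hpf, show (0.6 : ℝ) = 3 / 5 by norm_num, show (0.4 : ℝ) = 2 / 5 by norm_num,
        div_pow, div_pow, div_mul_div_comm, ← pow_add,
        HasAntidiagonal.mem_antidiagonal.1 hp, div_mul_div_comm]
      push_cast
      rfl
    rw [ht, excess_eq_natExcess, excess_eq_natExcess]
    gcongr
    exact natExcess_le_eleven i p hp
end
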